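/- Let n = 2k+1 with k ≥ 1, let A be the polynomial ring over ℚ in indeterminates a₂, …, a_{n+1} (with a₀ = 1, a₁ = 0, and a_j = 0 for j > n+1), let f = x^{n+1} + Σ_{j=2}^{n+1} a_j x^{n+1−j} ∈ A[x], let B = A[x]/(f), free over A with basis 1, x, …, x^n, and let π_! : B → A take the coefficient of x^n in this basis. Define c_i^{fw} = Σ_{j=0}^{i} C(n+1−j, i−j)·a_j·x^{i−j} ∈ B for i ≥ 0, p₁^{fw} = Σ_{j=0}^{2} (−1)^{j−1} c_j^{fw} c_{2−j}^{fw} = (n+1)x² − 2a₂, and e^{fw} = c_n^{fw}. Then the n elements π_!(e^{fw}·(p₁^{fw})^ℓ) for 1 ≤ ℓ ≤ k+1 together with π_!((p₁^{fw})^ℓ) for k+2 ≤ ℓ ≤ 2k+1 are algebraically independent over ℚ and generate A as a ℚ-algebra. -/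

import Mathlib

/-!
Statement 8: odd n = 2k+1.  With A = ℚ[a₂,…,a_{n+1}],
B = A[x]/(x^{n+1} + a₂x^{n−1} + ⋯ + a_{n+1}), π_! the coefficient of x^n,
c_i^{fw} = Σ_{j=0}^{i} C(n+1−j, i−j)·a_j·x^{i−j}, p₁^{fw} = Σ_{j=0}^{2} (−1)^{j−1}
c_j^{fw} c_{2−j}^{fw} and e^{fw} = c_n^{fw}, the n elements π_!(e^{fw}·(p₁^{fw})^ℓ)
(1 ≤ ℓ ≤ k+1) and π_!((p₁^{fw})^ℓ) (k+2 ≤ ℓ ≤ 2k+1) are algebraically independent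
over ℚ and generate A as a ℚ-algebra.
-/

noncomputable section

open Polynomial

/-- The polynomial ring A = ℚ[a₂,…,a_{n+1}]. -/
abbrev ARing (n : ℕ) : Type := MvPolynomial {j : ℕ // 2 ≤ j ∧ j ≤ n + 1} ℚ

/-- The element a_j, with conventions a₀ = 1, a₁ = 0 and a_j = 0 for j > n+1. -/
def aGen (n : ℕ) (j : ℕ) : ARing n :=
  if j = 0 then 1 else if h : 2 ≤ j ∧ j ≤ n + 1 then MvPolynomial.X ⟨j, h⟩ else 0

/-- The monic polynomial f = x^{n+1} + Σ_{j=2}^{n+1} a_j x^{n+1−j}. -/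
def fPoly (n : ℕ) : Polynomial (ARing n) :=
  X ^ (n + 1) + ∑ j ∈ Finset.Icc 2 (n + 1), C (aGen n j) * X ^ (n + 1 - j)

/-- π_! : B = A[x]/(f) → A, extracting the coefficient of x^n in the basis 1, x, …, x^n;
computed on the canonical representative modulo the monic f. -/
def piShriek (n : ℕ) (g : Polynomial (ARing n)) : ARing n := (g %ₘ fPoly n).coeff n

/-- The fiberwise Chern class c_i^{fw} = Σ_{j=0}^{i} C(n+1−j, i−j)·a_j·x^{i−j}. -/
def cfw (n : ℕ) (i : ℕ) : Polynomial (ARing n) :=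
  ∑ j ∈ Finset.range (i + 1),
    C ((((n + 1 - j).choose (i - j) : ℕ) : ARing n) * aGen n j) * X ^ (i - j)

/-- The fiberwise first Pontryagin class
p₁^{fw} = Σ_{j=0}^{2} (−1)^{j−1} c_j^{fw} c_{2−j}^{fw} (= (n+1)x² − 2a₂). -/
def p1fw (n : ℕ) : Polynomial (ARing n) :=
  ∑ j ∈ Finset.range 3, (-1 : Polynomial (ARing n)) ^ (j + 1) * cfw n j * cfw n (2 - j)

/-- The fiberwise Euler class e^{fw} = c_n^{fw}. -/
def efw (n : ℕ) : Polynomial (ARing n) := cfw n n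

/-- The family of the n = 2k+1 elements π_!(e^{fw}·(p₁^{fw})^ℓ) for 1 ≤ ℓ ≤ k+1
and π_!((p₁^{fw})^ℓ) for k+2 ≤ ℓ ≤ 2k+1. -/
def oddFam (k : ℕ) : (Fin (k + 1) ⊕ Fin k) → ARing (2 * k + 1) := fun v =>
  match v with
  | Sum.inl l => piShriek (2 * k + 1) (efw (2 * k + 1) * p1fw (2 * k + 1) ^ ((l : ℕ) + 1))
  | Sum.inr l => piShriek (2 * k + 1) (p1fw (2 * k + 1) ^ (k + 2 + (l : ℕ)))

/-- A surjective endomorphism of a Noetherian ring is injective. -/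
theorem injective_of_surjective_ringEnd {R : Type*} [CommRing R] [IsNoetherianRing R]
    (φ : R →+* R) (hφ : Function.Surjective φ) : Function.Injective φ := by
  have hker : Monotone fun m : ℕ => RingHom.ker (φ ^ m) := by
    refine monotone_nat_of_le_succ fun m x hx => ?_
    rw [RingHom.mem_ker] at hx ⊢
    rw [pow_succ', RingHom.mul_def, RingHom.comp_apply, hx, map_zero]
  obtain ⟨m, hm⟩ := monotone_stabilizes_iff_noetherian.mpr ‹IsNoetherianRing R› ⟨_, hker⟩
  rw [injective_iff_map_eq_zero]
  intro x hx
  have hsurj : Function.Surjective (φ ^ m) := by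
    rw [RingHom.coe_pow]
    exact hφ.iterate m
  obtain ⟨y, rfl⟩ := hsurj x
  have hy : y ∈ RingHom.ker (φ ^ (m + 1)) := by
    rw [RingHom.mem_ker, pow_succ', RingHom.mul_def, RingHom.comp_apply, hx]
  have hle : RingHom.ker (φ ^ m) = RingHom.ker (φ ^ (m + 1)) := hm (m + 1) (Nat.le_succ m)
  rw [← hle, RingHom.mem_ker] at hy
  exact hy

/-- A generating family of a polynomial ring with as many elements as there are variables is
algebraically independent. -/
theorem algebraicIndependent_of_adjoin_eq_top {K σ ι : Type*} [Field K] [Finite σ]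
    (e : ι ≃ σ) (v : ι → MvPolynomial σ K) (hv : Algebra.adjoin K (Set.range v) = ⊤) :
    AlgebraicIndependent K v := by
  have hsurj : Function.Surjective (MvPolynomial.aeval (R := K) v) := by
    rw [← AlgHom.range_eq_top, ← Algebra.adjoin_range_eq_range_aeval, hv]
  let r := MvPolynomial.renameEquiv K e.symm
  have hinj := injective_of_surjective_ringEnd
    ((MvPolynomial.aeval (R := K) v).toRingHom.comp (r : MvPolynomial σ K →+* MvPolynomial ι K))
    (hsurj.comp r.surjective)
  refine Function.Injective.of_comp_right (g := r) ?_ r.surjective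
  exact hinj

theorem aGen_zero (n : ℕ) : aGen n 0 = 1 := by simp [aGen]

theorem aGen_one (n : ℕ) : aGen n 1 = 0 := by simp [aGen]

theorem aGen_of_lt {n j : ℕ} (h : n + 1 < j) : aGen n j = 0 := by
  have h0 : j ≠ 0 := by omega
  have h1 : ¬ (2 ≤ j ∧ j ≤ n + 1) := by omega
  simp [aGen, h0, h1]

theorem aGen_val {n : ℕ} (j : {j : ℕ // 2 ≤ j ∧ j ≤ n + 1}) :
    aGen n j = MvPolynomial.X j := by
  have h0 : (j : ℕ) ≠ 0 := by have := j.2; omega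
  simp [aGen, h0, j.2]

theorem fPoly_eq (n : ℕ) :
    fPoly n = ∑ j ∈ Finset.range (n + 2), C (aGen n j) * X ^ (n + 1 - j) := by
  rw [Finset.range_eq_Ico, Finset.sum_eq_sum_Ico_succ_bot (by omega),
    Finset.sum_eq_sum_Ico_succ_bot (by omega), fPoly, aGen_zero, aGen_one]
  simp only [map_one, one_mul, map_zero, zero_mul, zero_add, Nat.sub_zero]
  rfl

theorem degree_fPoly_tail_lt (n : ℕ) :
    (∑ j ∈ Finset.Icc 2 (n + 1), C (aGen n j) * X ^ (n + 1 - j)).degree < ((n + 1 : ℕ) : WithBot ℕ) := by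
  refine (degree_sum_le _ _).trans_lt ((Finset.sup_lt_iff (WithBot.bot_lt_coe _)).mpr ?_)
  intro j hj
  rw [Finset.mem_Icc] at hj
  refine (degree_C_mul_X_pow_le _ _).trans_lt ?_
  exact_mod_cast (by omega : n + 1 - j < n + 1)

theorem monic_fPoly (n : ℕ) : (fPoly n).Monic := monic_X_pow_add (degree_fPoly_tail_lt n)

theorem degree_fPoly (n : ℕ) : (fPoly n).degree = (n + 1 : ℕ) := by
  rw [fPoly, degree_add_eq_left_of_degree_lt, degree_X_pow]
  rw [degree_X_pow]
  exact degree_fPoly_tail_lt n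

/-- Fiber integration as a linear map. -/
def piLin (n : ℕ) : Polynomial (ARing n) →ₗ[ARing n] ARing n :=
  (lcoeff (ARing n) n).comp (modByMonicHom (fPoly n))

theorem piLin_apply (n : ℕ) (g : Polynomial (ARing n)) : piLin n g = piShriek n g := rfl

theorem piLin_C_mul (n : ℕ) (a : ARing n) (g : Polynomial (ARing n)) :
    piLin n (C a * g) = a * piLin n g := by
  rw [← smul_eq_C_mul, map_smul, smul_eq_mul]

theorem piLin_X_pow {n i : ℕ} (h : i ≤ n) : piLin n (X ^ i) = if i = n then 1 else 0 := by
  rw [piLin_apply, piShriek, (modByMonic_eq_self_iff (monic_fPoly n)).mpr, coeff_X_pow]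
  · simp [eq_comm]
  · rw [degree_fPoly, degree_X_pow]
    exact_mod_cast (by omega : i < n + 1)

theorem sum_aGen_mul_piLin_X_pow (n : ℕ) {m : ℕ} (hm : 1 ≤ m) :
    ∑ j ∈ Finset.range (n + 2), aGen n j * piLin n (X ^ (n + m - j)) = 0 := by
  have h : piLin n (fPoly n * X ^ (m - 1)) = 0 := by
    rw [piLin_apply, piShriek,
      (modByMonic_eq_zero_iff_dvd (monic_fPoly n)).mpr (dvd_mul_right _ _), coeff_zero]
  rw [fPoly_eq, Finset.sum_mul, map_sum] at h
  rw [← h]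
  refine Finset.sum_congr rfl fun j hj => ?_
  rw [Finset.mem_range] at hj
  rw [mul_assoc, piLin_C_mul, ← pow_add]
  congr 3
  omega

/-- The subalgebra generated by the `a_j` with `j < m`. -/
def lowerAlg (n m : ℕ) : Subalgebra ℚ (ARing n) := Algebra.adjoin ℚ (aGen n '' Set.Iio m)

theorem lowerAlg_mono (n : ℕ) : Monotone (lowerAlg n) := fun _ _ h =>
  Algebra.adjoin_mono (Set.image_mono (Set.Iio_subset_Iio h))

theorem aGen_mem_lowerAlg {n j m : ℕ} (h : j < m) : aGen n j ∈ lowerAlg n m :=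
  Algebra.subset_adjoin ⟨j, h, rfl⟩

theorem piLin_X_pow_mem (n i : ℕ) : piLin n (X ^ i) ∈ lowerAlg n (i + 1 - n) := by
  induction i using Nat.strong_induction_on with
  | _ i ih =>
    rcases le_or_gt i n with h | h
    · rw [piLin_X_pow h]
      split_ifs
      · exact one_mem _
      · exact zero_mem _
    · obtain ⟨m, rfl⟩ := Nat.exists_eq_add_of_lt h
      have h0 := sum_aGen_mul_piLin_X_pow n (m := m + 1) (by omega)
      rw [Finset.sum_range_succ', aGen_zero, one_mul, Nat.sub_zero, add_comm,
        ← eq_neg_iff_add_eq_zero] at h0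
      rw [add_assoc n m 1, h0]
      refine neg_mem (sum_mem fun j hjn => ?_)
      rw [Finset.mem_range] at hjn
      rcases le_or_gt j m with hj | hj
      · exact mul_mem (aGen_mem_lowerAlg (by omega))
          (lowerAlg_mono n (by omega) (ih (n + (m + 1) - (j + 1)) (by omega)))
      · rw [piLin_X_pow (by omega)]
        split_ifs
        · omega
        · rw [mul_zero]
          exact zero_mem _

/-- In a weighted sum of the products `a_j π_!(x^{n+m-j})`, only the terms `j = 0` and `j = m`
can contribute to the coefficient of `a_m`. -/
theorem weighted_sum_sub_mem {n m : ℕ} (u : ℕ → ℕ) (hm : 1 ≤ m) (hmn : m ≤ n + 1) :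
    ∑ j ∈ Finset.range (n + 2), (u j : ARing n) * (aGen n j * piLin n (X ^ (n + m - j))) -
      (u 0 : ARing n) * piLin n (X ^ (n + m)) - (u m : ARing n) * aGen n m ∈ lowerAlg n m := by
  have key : ∑ j ∈ Finset.range (n + 2),
      ((u j : ARing n) * (aGen n j * piLin n (X ^ (n + m - j))) -
        (if j = 0 then (u 0 : ARing n) * piLin n (X ^ (n + m)) else 0) -
        (if j = m then (u m : ARing n) * aGen n m else 0)) ∈ lowerAlg n m := by
    refine sum_mem fun j hjn => ?_
    rw [Finset.mem_range] at hjn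
    rcases Nat.eq_zero_or_pos j with rfl | hj
    · have : (0 : ℕ) ≠ m := by omega
      simp [this, aGen_zero]
    rw [if_neg hj.ne', sub_zero]
    rcases lt_trichotomy j m with h | rfl | h
    · rw [if_neg h.ne, sub_zero]
      exact mul_mem (natCast_mem _ _) (mul_mem (aGen_mem_lowerAlg h)
        (lowerAlg_mono n (by omega) (piLin_X_pow_mem n _)))
    · rw [if_pos rfl, Nat.add_sub_cancel, piLin_X_pow le_rfl, if_pos rfl, mul_one, sub_self]
      exact zero_mem _
    · rw [if_neg h.ne', sub_zero, piLin_X_pow (by omega)]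
      split_ifs
      · omega
      · rw [mul_zero, mul_zero]
        exact zero_mem _
  rw [Finset.sum_sub_distrib, Finset.sum_sub_distrib, Finset.sum_ite_eq', Finset.sum_ite_eq',
    if_pos (by simp), if_pos (by simp; omega)] at key
  exact key

theorem piLin_X_pow_add_aGen_mem {n m : ℕ} (hm : 1 ≤ m) (hmn : m ≤ n + 1) :
    piLin n (X ^ (n + m)) + aGen n m ∈ lowerAlg n m := by
  have h := weighted_sum_sub_mem (fun _ => 1) hm hmn
  simp only [Nat.cast_one, one_mul, sum_aGen_mul_piLin_X_pow n hm] at h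
  have h' := neg_mem h
  convert h' using 1
  ring

theorem piLin_efw_mul_X_pow (n m : ℕ) :
    piLin n (efw n * X ^ m) = ∑ j ∈ Finset.range (n + 2),
      ((n + 1 - j : ℕ) : ARing n) * (aGen n j * piLin n (X ^ (n + m - j))) := by
  rw [Finset.sum_range_succ, Nat.sub_self, Nat.cast_zero, zero_mul, add_zero, efw, cfw,
    Finset.sum_mul, map_sum]
  refine Finset.sum_congr rfl fun j hj => ?_
  rw [Finset.mem_range] at hj
  have hc : n + 1 - j = (n - j) + 1 := by omega
  have he : n - j + m = n + m - j := by omega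
  rw [mul_assoc, piLin_C_mul, ← pow_add, mul_assoc, he, hc, Nat.choose_succ_self_right]

theorem piLin_efw_mul_X_pow_add_mem {n m : ℕ} (hm : 1 ≤ m) (hmn : m ≤ n + 1) :
    piLin n (efw n * X ^ m) + (m : ARing n) * aGen n m ∈ lowerAlg n m := by
  have h := weighted_sum_sub_mem (fun j => n + 1 - j) hm hmn
  rw [← piLin_efw_mul_X_pow] at h
  have h' := add_mem h (mul_mem (natCast_mem (lowerAlg n m) (n + 1))
    (piLin_X_pow_add_aGen_mem hm hmn))
  convert h' using 1
  rw [Nat.cast_sub hmn, Nat.sub_zero]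
  ring

theorem piLin_efw (n : ℕ) : piLin n (efw n) = (n + 1 : ℕ) := by
  have h := piLin_efw_mul_X_pow n 0
  rw [pow_zero, mul_one] at h
  rw [h, Finset.sum_eq_single 0]
  · simp [aGen_zero, piLin_X_pow]
  · intro j _ hj
    rw [piLin_X_pow (by omega)]
    split_ifs
    · have : j = 0 ∨ n = 0 := by omega
      rcases this with rfl | rfl
      · exact absurd rfl hj
      · rcases Nat.eq_or_lt_of_le (Nat.one_le_iff_ne_zero.mpr hj) with rfl | h1
        · simp
        · simp [aGen_of_lt h1]
    · simp
  · simp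

theorem piLin_efw_mul_X_pow_mem {n m : ℕ} (hmn : m ≤ n + 1) :
    piLin n (efw n * X ^ m) ∈ lowerAlg n (m + 1) := by
  rcases Nat.eq_zero_or_pos m with rfl | hm
  · rw [pow_zero, mul_one, piLin_efw]
    exact natCast_mem _ _
  · have h := sub_mem (lowerAlg_mono n (Nat.le_succ m) (piLin_efw_mul_X_pow_add_mem hm hmn))
      (mul_mem (natCast_mem (lowerAlg n (m + 1)) m) (aGen_mem_lowerAlg (Nat.lt_succ_self m)))
    rwa [add_sub_cancel_right] at h

theorem p1fw_eq (n : ℕ) :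
    p1fw n = C ((n + 1 : ℕ) : ARing n) * X ^ 2 + C (-2 * aGen n 2) := by
  have hc : (((n + 1).choose 2 : ℕ) : Polynomial (ARing n)) * 2 = (n + 1) * n := by
    have h := Nat.add_one_mul_choose_eq n 1
    rw [Nat.choose_one_right] at h
    exact_mod_cast h.symm
  simp only [p1fw, cfw, Finset.sum_range_succ, Finset.sum_range_zero, aGen_zero, aGen_one]
  simp
  simp only [aGen_zero, aGen_one, map_one, map_zero, map_ofNat]
  linear_combination (-X ^ 2) * hc

theorem map_p1fw_pow_sub_mem {n ℓ : ℕ} (L : Polynomial (ARing n) →ₗ[ARing n] ARing n)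
    (S : Subalgebra ℚ (ARing n)) (h2 : aGen n 2 ∈ S) (hL : ∀ i < ℓ, L (X ^ (2 * i)) ∈ S) :
    L (p1fw n ^ ℓ) - ((n + 1 : ℕ) : ARing n) ^ ℓ * L (X ^ (2 * ℓ)) ∈ S := by
  have hterm (i : ℕ) : L ((C ((n + 1 : ℕ) : ARing n) * X ^ 2) ^ i *
      C (-2 * aGen n 2) ^ (ℓ - i) * (ℓ.choose i : Polynomial (ARing n))) =
      ((n + 1 : ℕ) : ARing n) ^ i * (-2 * aGen n 2) ^ (ℓ - i) * (ℓ.choose i : ARing n) *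
        L (X ^ (2 * i)) := by
    rw [← smul_eq_mul (b := L _), ← map_smul, smul_eq_C_mul]
    congr 1
    simp only [map_mul, map_pow, map_natCast]
    ring
  rw [p1fw_eq, add_pow, map_sum, Finset.sum_range_succ, hterm ℓ]
  simp only [Nat.sub_self, pow_zero, mul_one, Nat.choose_self, Nat.cast_one, add_sub_cancel_right]
  refine sum_mem fun i hi => ?_
  rw [hterm i]
  have hneg : (-2 : ARing n) ∈ S := neg_mem (ofNat_mem S 2)
  exact mul_mem (mul_mem (mul_mem (pow_mem (natCast_mem _ _) _) (pow_mem (mul_mem hneg h2) _))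
    (natCast_mem _ _)) (hL i (Finset.mem_range.mp hi))

theorem piShriek_efw_mul_p1fw_add_mem {n : ℕ} (hn : 1 ≤ n) :
    piShriek n (efw n * p1fw n) + ((4 * (n + 1) : ℕ) : ARing n) * aGen n 2 ∈ lowerAlg n 2 := by
  have h := mul_mem (natCast_mem (lowerAlg n 2) (n + 1))
    (piLin_efw_mul_X_pow_add_mem (n := n) (m := 2) (by omega) (by omega))
  convert h using 1
  have : efw n * p1fw n = C ((n + 1 : ℕ) : ARing n) * (efw n * X ^ 2) +
      C (-2 * aGen n 2) * efw n := by
    rw [p1fw_eq]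
    ring
  rw [← piLin_apply, this, map_add, piLin_C_mul, piLin_C_mul, piLin_efw]
  push_cast
  ring

theorem piShriek_efw_mul_p1fw_pow_add_mem {n ℓ : ℕ} (hℓ : 2 ≤ ℓ) (hn : 2 * ℓ ≤ n + 1) :
    piShriek n (efw n * p1fw n ^ ℓ) +
      (((n + 1) ^ ℓ * (2 * ℓ) : ℕ) : ARing n) * aGen n (2 * ℓ) ∈ lowerAlg n (2 * ℓ) := by
  have h := map_p1fw_pow_sub_mem (ℓ := ℓ) ((piLin n).comp (LinearMap.mulLeft (ARing n) (efw n)))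
    (lowerAlg n (2 * ℓ)) (aGen_mem_lowerAlg (by omega)) fun i hi =>
      lowerAlg_mono n (by omega) (piLin_efw_mul_X_pow_mem (n := n) (m := 2 * i) (by omega))
  have h' := add_mem h (mul_mem (pow_mem (natCast_mem (lowerAlg n (2 * ℓ)) (n + 1)) ℓ)
    (piLin_efw_mul_X_pow_add_mem (n := n) (m := 2 * ℓ) (by omega) hn))
  convert h' using 1
  simp only [LinearMap.comp_apply, LinearMap.mulLeft_apply, piLin_apply]
  push_cast
  ring

theorem piShriek_p1fw_pow_add_mem {n m ℓ : ℕ} (hℓ : 2 * ℓ = n + m) (hm : 3 ≤ m)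
    (hn : m ≤ n + 1) :
    piShriek n (p1fw n ^ ℓ) + (((n + 1) ^ ℓ : ℕ) : ARing n) * aGen n m ∈ lowerAlg n m := by
  have h := map_p1fw_pow_sub_mem (ℓ := ℓ) (piLin n) (lowerAlg n m)
    (aGen_mem_lowerAlg (by omega)) fun i hi =>
      lowerAlg_mono n (by omega) (piLin_X_pow_mem n (2 * i))
  have h' := add_mem h (mul_mem (pow_mem (natCast_mem (lowerAlg n m) (n + 1)) ℓ)
    (piLin_X_pow_add_aGen_mem (n := n) (m := m) (by omega) hn))
  convert h' using 1
  rw [hℓ, piLin_apply]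
  push_cast
  ring

theorem exists_oddFam_add_mem {k w : ℕ} (h2 : 2 ≤ w) (hw : w ≤ 2 * k + 2) :
    ∃ v, ∃ c : ℕ, c ≠ 0 ∧
      oddFam k v + (c : ARing (2 * k + 1)) * aGen (2 * k + 1) w ∈ lowerAlg (2 * k + 1) w := by
  rcases Nat.even_or_odd' w with ⟨l, rfl | rfl⟩
  · obtain ⟨l, rfl⟩ : ∃ l', l = l' + 1 := ⟨l - 1, by omega⟩
    refine ⟨Sum.inl ⟨l, by omega⟩, ?_⟩
    rcases Nat.eq_zero_or_pos l with rfl | hl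
    · refine ⟨4 * (2 * k + 1 + 1), by omega, ?_⟩
      simpa only [oddFam, zero_add, pow_one] using
        piShriek_efw_mul_p1fw_add_mem (n := 2 * k + 1) (by omega)
    · exact ⟨(2 * k + 1 + 1) ^ (l + 1) * (2 * (l + 1)), by positivity,
        piShriek_efw_mul_p1fw_pow_add_mem (by omega) (by omega)⟩
  · exact ⟨Sum.inr ⟨l - 1, by omega⟩, (2 * k + 1 + 1) ^ (k + 2 + (l - 1)), by positivity,
      piShriek_p1fw_pow_add_mem (by dsimp only; omega) (by omega) (by omega)⟩

theorem aGen_mem_adjoin_oddFam (k w : ℕ) :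
    aGen (2 * k + 1) w ∈ Algebra.adjoin ℚ (Set.range (oddFam k)) := by
  induction w using Nat.strong_induction_on with
  | _ w ih =>
    rcases Nat.lt_or_ge w 2 with h | h2
    · interval_cases w
      · rw [aGen_zero]
        exact one_mem _
      · rw [aGen_one]
        exact zero_mem _
    rcases Nat.lt_or_ge (2 * k + 2) w with h | hw
    · rw [aGen_of_lt h]
      exact zero_mem _
    obtain ⟨v, c, hc, hmem⟩ := exists_oddFam_add_mem h2 hw
    have hle : lowerAlg (2 * k + 1) w ≤ Algebra.adjoin ℚ (Set.range (oddFam k)) := by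
      refine Algebra.adjoin_le ?_
      rintro _ ⟨j, hj, rfl⟩
      exact ih j hj
    have h := sub_mem (hle hmem) (Algebra.subset_adjoin (Set.mem_range_self v))
    rw [add_sub_cancel_left, ← nsmul_eq_mul, ← Nat.cast_smul_eq_nsmul ℚ] at h
    have h' := Subalgebra.smul_mem _ h ((c : ℚ)⁻¹)
    rwa [inv_smul_smul₀ (Nat.cast_ne_zero.mpr hc)] at h'

theorem adjoin_range_oddFam (k : ℕ) : Algebra.adjoin ℚ (Set.range (oddFam k)) = ⊤ := by
  rw [eq_top_iff, ← MvPolynomial.adjoin_range_X]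
  refine Algebra.adjoin_le ?_
  rintro _ ⟨j, rfl⟩
  rw [SetLike.mem_coe, ← aGen_val]
  exact aGen_mem_adjoin_oddFam k j

/-- The members of `oddFam k` are as many as the variables. -/
theorem nonempty_equiv_vars (k : ℕ) :
    Nonempty (Fin (k + 1) ⊕ Fin k ≃ {j : ℕ // 2 ≤ j ∧ j ≤ 2 * k + 1 + 1}) := by
  have e : {j : ℕ // 2 ≤ j ∧ j ≤ 2 * k + 1 + 1} ≃ Finset.Icc 2 (2 * k + 1 + 1) :=
    Equiv.subtypeEquivRight fun j => Finset.mem_Icc.symm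
  refine ⟨(Fintype.equivOfCardEq ?_).trans e.symm⟩
  simp only [Fintype.card_sum, Fintype.card_fin, Fintype.card_coe, Nat.card_Icc]
  omega

theorem stmt8 (k : ℕ) (hk : 1 ≤ k) :
    AlgebraicIndependent ℚ (oddFam k) ∧
    Algebra.adjoin ℚ (Set.range (oddFam k)) = ⊤ := by
  obtain ⟨e⟩ := nonempty_equiv_vars k
  have : Finite {j : ℕ // 2 ≤ j ∧ j ≤ 2 * k + 1 + 1} := Finite.of_equiv _ e
  exact ⟨algebraicIndependent_of_adjoin_eq_top e _ (adjoin_range_oddFam k), adjoin_range_oddFam k⟩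

end
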